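/- For every n ∈ ℕ, the identity x^n = ∑_{k=0}^{⌊n/2⌋} [n choose k]_q L_{n−2k}(x,q) holds in ℚ(q)[x]. -/

import Mathlib

open Finset Polynomial

/-- The indeterminate `q`, viewed in the field `ℚ(q)` of rational functions. -/
noncomputable def q : RatFunc ℚ := RatFunc.X

/-- `[n] = (1 - q^n)/(1 - q)` in `ℚ(q)`. -/
noncomputable def qint (n : ℕ) : RatFunc ℚ := (1 - q ^ n) / (1 - q)

/-- The Gaussian binomial coefficient `[n choose k]_q` in `ℚ(q)`. -/
noncomputable def qbinom (n k : ℤ) : RatFunc ℚ :=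
  if 0 ≤ k ∧ k ≤ n then
    ∏ i ∈ Finset.range k.toNat, (1 - q ^ (n - k + (i : ℤ) + 1)) / (1 - q ^ ((i : ℤ) + 1))
  else if k = 0 then 1 else 0

/-- The q-Lucas polynomial: `L_0(x,q) = 1` and, for `n ≥ 1`,
`L_n(x,q) = ∑_{k=0}^{⌊n/2⌋} (−1)^k q^{k(k−1)/2} ([n]/[n−k]) [n−k choose k]_q x^{n−2k}`. -/
noncomputable def qLucas (n : ℕ) : Polynomial (RatFunc ℚ) :=
  if n = 0 then 1
  else ∑ k ∈ Finset.range (n / 2 + 1),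
    Polynomial.C ((-1 : RatFunc ℚ) ^ k * q ^ (k * (k - 1) / 2) * (qint n / qint (n - k)) *
        qbinom ((n : ℤ) - k) k) *
      Polynomial.X ^ (n - 2 * k)

lemma q_pow_ne_one {i : ℕ} (hi : i ≠ 0) : q ^ i ≠ 1 := by
  intro h
  have hX : (X : ℚ[X]) ^ i = 1 := by
    apply RatFunc.algebraMap_injective ℚ
    simpa [q] using h
  have := congrArg natDegree hX
  simp [hi] at this

lemma one_sub_q_pow_ne_zero {i : ℕ} (hi : i ≠ 0) : 1 - q ^ i ≠ 0 :=
  sub_ne_zero.2 (q_pow_ne_one hi).symm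

lemma one_sub_q_ne_zero : 1 - q ≠ 0 := by
  simpa using one_sub_q_pow_ne_zero one_ne_zero

/-- The `q`-Pochhammer symbol `(q; q)_n = ∏_{i=1}^n (1 - q^i)`. -/
noncomputable def qPochhammer (n : ℕ) : RatFunc ℚ := ∏ i ∈ range n, (1 - q ^ (i + 1))

lemma qPochhammer_ne_zero (n : ℕ) : qPochhammer n ≠ 0 :=
  prod_ne_zero_iff.2 fun _ _ => one_sub_q_pow_ne_zero (Nat.succ_ne_zero _)

lemma qPochhammer_succ (n : ℕ) : qPochhammer (n + 1) = qPochhammer n * (1 - q ^ (n + 1)) :=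
  prod_range_succ _ _

lemma qbinom_add_eq_div (a k : ℕ) :
    qbinom ((a + k : ℕ) : ℤ) k = qPochhammer (a + k) / (qPochhammer k * qPochhammer a) := by
  have hprod : qPochhammer (a + k) = qPochhammer a * ∏ i ∈ range k, (1 - q ^ (a + i + 1)) :=
    prod_range_add _ _ _
  have hq : qbinom ((a + k : ℕ) : ℤ) k =
      ∏ i ∈ range k, (1 - q ^ (a + i + 1)) / (1 - q ^ (i + 1)) := by
    rw [qbinom, if_pos (by omega), Int.toNat_natCast]
    refine prod_congr rfl fun i _ => ?_
    rw [show ((a + k : ℕ) : ℤ) - k + i + 1 = ((a + i + 1 : ℕ) : ℤ) by push_cast; ring,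
      show (i : ℤ) + 1 = ((i + 1 : ℕ) : ℤ) by push_cast; ring, zpow_natCast, zpow_natCast]
  rw [hq, prod_div_distrib, hprod]
  change _ / qPochhammer k = _
  field_simp [qPochhammer_ne_zero]

lemma qbinom_zero_right (n : ℤ) : qbinom n 0 = 1 := by
  simp [qbinom]

lemma qbinom_succ_right_mul {n k : ℕ} (h : k < n) :
    qbinom n ((k + 1 : ℕ) : ℤ) * (1 - q ^ (k + 1)) = qbinom n k * (1 - q ^ (n - k)) := by
  obtain ⟨a, rfl⟩ := Nat.exists_eq_add_of_lt h
  have h₁ := qbinom_add_eq_div a (k + 1)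
  have h₂ := qbinom_add_eq_div (a + 1) k
  rw [show a + (k + 1) = k + a + 1 by ring] at h₁
  rw [show a + 1 + k = k + a + 1 by ring] at h₂
  rw [h₁, h₂, show k + a + 1 - k = a + 1 by omega, qPochhammer_succ k, qPochhammer_succ a]
  have := qPochhammer_ne_zero k
  have := qPochhammer_ne_zero a
  have := one_sub_q_pow_ne_zero k.succ_ne_zero
  have := one_sub_q_pow_ne_zero a.succ_ne_zero
  field_simp

lemma qbinom_succ_succ_mul {n k : ℕ} (h : k ≤ n) :
    qbinom ((n + 1 : ℕ) : ℤ) ((k + 1 : ℕ) : ℤ) * (1 - q ^ (k + 1)) =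
      (1 - q ^ (n + 1)) * qbinom n k := by
  obtain ⟨a, rfl⟩ := Nat.exists_eq_add_of_le' h
  rw [add_assoc, qbinom_add_eq_div, qbinom_add_eq_div, ← add_assoc, qPochhammer_succ,
    qPochhammer_succ]
  have := qPochhammer_ne_zero k
  have := qPochhammer_ne_zero a
  have := one_sub_q_pow_ne_zero k.succ_ne_zero
  field_simp

/-- The coefficient of `x^(n - 2k)` in the `q`-Lucas polynomial `L_n`. -/
noncomputable def qLucasCoeff (n k : ℕ) : RatFunc ℚ :=
  if n = 0 then 1
  else (-1) ^ k * q ^ (k * (k - 1) / 2) * (qint n / qint (n - k)) * qbinom ((n : ℤ) - k) k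

lemma qLucas_eq_sum (n : ℕ) :
    qLucas n = ∑ k ∈ range (n / 2 + 1), C (qLucasCoeff n k) * X ^ (n - 2 * k) := by
  by_cases hn : n = 0
  · simp [hn, qLucas, qLucasCoeff]
  · simp only [qLucas, qLucasCoeff, if_neg hn]

lemma qLucasCoeff_zero_right (n : ℕ) : qLucasCoeff n 0 = 1 := by
  by_cases hn : n = 0
  · simp [hn, qLucasCoeff]
  · have h : qint n ≠ 0 := div_ne_zero (one_sub_q_pow_ne_zero hn) one_sub_q_ne_zero
    simp [qLucasCoeff, hn, qbinom_zero_right, h]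

lemma qLucasCoeff_succ_mul {a j : ℕ} (h : j ≤ a) :
    qLucasCoeff (a + j + 2) (j + 1) * (1 - q ^ (j + 1)) =
      (-1) ^ (j + 1) * q ^ ((j + 1) * j / 2) * (1 - q ^ (a + j + 2)) * qbinom a j := by
  have hb := qbinom_succ_succ_mul h
  have ha := one_sub_q_pow_ne_zero a.succ_ne_zero
  have h1 := one_sub_q_ne_zero
  rw [qLucasCoeff, if_neg (by omega),
    show ((a + j + 2 : ℕ) : ℤ) - ((j + 1 : ℕ) : ℤ) = ((a + 1 : ℕ) : ℤ) by push_cast; ring,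
    mul_assoc, hb, show a + j + 2 - (j + 1) = a + 1 by omega, qint, qint, Nat.add_sub_cancel]
  field_simp

/-- Closed form of the partial sums of the coefficient of `x^(n - 2m)` in
`∑ k, [n choose k] L_(n - 2k)`. -/
lemma one_sub_q_pow_mul_sum_qbinom_mul_qLucasCoeff {n m : ℕ} (hm : 2 * m ≤ n) {K : ℕ}
    (hK : K ≤ m) :
    (1 - q ^ m) * ∑ k ∈ range K, qbinom n k * qLucasCoeff (n - 2 * k) (m - k) =
      -((-1) ^ (m - K) * q ^ ((m - K + 1) * (m - K) / 2) * (1 - q ^ K) * qbinom n K *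
        qbinom ((n - m - K : ℕ) : ℤ) ((m - K : ℕ) : ℤ)) := by
  induction K with
  | zero => simp
  | succ K ih =>
    obtain ⟨j, rfl⟩ := Nat.exists_eq_add_of_lt hK
    obtain ⟨a, ha⟩ : ∃ a, n - (K + j + 1) - (K + 1) = a := ⟨_, rfl⟩
    obtain rfl : n = a + (K + j + 1) + (K + 1) := by omega
    have hja : j ≤ a := by omega
    have htri : (j + 1 + 1) * (j + 1) / 2 = (j + 1) * j / 2 + (j + 1) :=
      Nat.triangle_succ (j + 1)
    have hL := qLucasCoeff_succ_mul hja
    have hb := qbinom_succ_succ_mul hja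
    have hn := qbinom_succ_right_mul (n := a + (K + j + 1) + (K + 1)) (k := K) (by omega)
    have hj : 1 - q ^ (j + 1) ≠ 0 := one_sub_q_pow_ne_zero j.succ_ne_zero
    rw [sum_range_succ, mul_add, ih (by omega)]
    rw [ha, show a + (K + j + 1) + (K + 1) - (K + j + 1) - K = a + 1 by omega,
      show K + j + 1 - K = j + 1 by omega, show K + j + 1 - (K + 1) = j by omega,
      show a + (K + j + 1) + (K + 1) - 2 * K = a + j + 2 by omega, htri]
    rw [show a + (K + j + 1) + (K + 1) - K = a + j + K + 2 by omega] at hn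
    generalize qbinom ((a + (K + j + 1) + (K + 1) : ℕ) : ℤ) ((K + 1 : ℕ) : ℤ) = B' at *
    generalize qbinom ((a + (K + j + 1) + (K + 1) : ℕ) : ℤ) K = B at *
    generalize qbinom ((a + 1 : ℕ) : ℤ) ((j + 1 : ℕ) : ℤ) = D' at *
    generalize qbinom (a : ℤ) j = D at *
    generalize qLucasCoeff (a + j + 2) (j + 1) = ℓ at *
    apply mul_right_cancel₀ hj
    generalize (j + 1) * j / 2 = t at *
    linear_combination (1 - q ^ (K + j + 1)) * B * hL +
      (-1) ^ j * q ^ (t + (j + 1)) * (1 - q ^ K) * B * hb +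
      (-1) ^ j * q ^ t * D * (1 - q ^ (j + 1)) * hn

lemma sum_qbinom_mul_qLucasCoeff {n m : ℕ} (hm : 2 * m ≤ n) :
    ∑ k ∈ range (m + 1), qbinom n k * qLucasCoeff (n - 2 * k) (m - k) =
      if m = 0 then 1 else 0 := by
  split_ifs with h
  · simp [h, qbinom_zero_right, qLucasCoeff_zero_right]
  · apply (mul_eq_zero.1 _).resolve_left (one_sub_q_pow_ne_zero h)
    rw [sum_range_succ, mul_add, one_sub_q_pow_mul_sum_qbinom_mul_qLucasCoeff hm le_rfl]
    simp [qbinom_zero_right, qLucasCoeff_zero_right]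

theorem pow_eq_sum_qLucas (n : ℕ) :
    (Polynomial.X : Polynomial (RatFunc ℚ)) ^ n =
      ∑ k ∈ Finset.range (n / 2 + 1), Polynomial.C (qbinom n k) * qLucas (n - 2 * k) := by
  have hterm : ∀ k ∈ range (n / 2 + 1), C (qbinom n k) * qLucas (n - 2 * k) =
      ∑ j ∈ range (n / 2 + 1 - k),
        C (qbinom n k * qLucasCoeff (n - 2 * k) j) * X ^ (n - 2 * (k + j)) := by
    intro k hk
    rw [mem_range] at hk
    rw [qLucas_eq_sum, mul_sum, show (n - 2 * k) / 2 + 1 = n / 2 + 1 - k by omega]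
    refine sum_congr rfl fun j _ => ?_
    rw [C_mul, mul_assoc, show n - 2 * k - 2 * j = n - 2 * (k + j) by omega]
  have hcoeff : ∀ m ∈ range (n / 2 + 1), ∑ k ∈ range (m + 1),
      C (qbinom n k * qLucasCoeff (n - 2 * k) (m - k)) * X ^ (n - 2 * (k + (m - k))) =
        if m = 0 then X ^ n else 0 := by
    intro m hm
    rw [mem_range] at hm
    have hX : ∀ k ∈ range (m + 1),
        C (qbinom n k * qLucasCoeff (n - 2 * k) (m - k)) * X ^ (n - 2 * (k + (m - k))) =
          C (qbinom n k * qLucasCoeff (n - 2 * k) (m - k)) * X ^ (n - 2 * m) := by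
      intro k hk
      rw [Nat.add_sub_cancel' (Nat.lt_succ_iff.1 (mem_range.1 hk))]
    rw [sum_congr rfl hX, ← sum_mul, ← map_sum, sum_qbinom_mul_qLucasCoeff (by omega)]
    split_ifs with h <;> simp [h]
  rw [sum_congr rfl hterm, ← sum_range_diag_flip (n / 2 + 1) fun k j =>
    C (qbinom n k * qLucasCoeff (n - 2 * k) j) * X ^ (n - 2 * (k + j)), sum_congr rfl hcoeff]
  simp
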